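/- For every n ≥ 1, the sum over all set partitions λ of [n] of the dimension exponent d(λ) equals −2B_{n+2} + (n+4)B_{n+1}. -/

import Mathlib

open Finset

/-- Set partitions of `[n]`, modeled as finpartitions of `Fin n`. -/
abbrev SetPartition (n : ℕ) := Finpartition (Finset.univ : Finset (Fin n))

/-- The `n`-th Bell number: the number of set partitions of `[n]`. -/
def bell (n : ℕ) : ℕ := Fintype.card (SetPartition n)

/-- `i` and `j` lie in the same block of the partition. -/
def SameBlock {n : ℕ} (P : SetPartition n) (i j : Fin n) : Prop :=
  ∃ b ∈ P.parts, i ∈ b ∧ j ∈ b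

/-- `i` is the smallest element of its block. -/
def IsFirst {n : ℕ} (P : SetPartition n) (i : Fin n) : Prop :=
  ∀ j, SameBlock P i j → i ≤ j

/-- `i` is the largest element of its block. -/
def IsLast {n : ℕ} (P : SetPartition n) (i : Fin n) : Prop :=
  ∀ j, SameBlock P i j → j ≤ i

/-- `(i, j)` is an arc: `i < j`, both in the same block, and `j` is the smallest
element of that block greater than `i`. -/
def IsArc {n : ℕ} (P : SetPartition n) (i j : Fin n) : Prop :=
  i < j ∧ SameBlock P i j ∧ ∀ k, i < k → k < j → ¬ SameBlock P i k

/-- The dimension exponent `d(λ) = Σ_blocks (max - min + 1) - n`. -/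
def dimExp {n : ℕ} (P : SetPartition n) : ℤ :=
  (∑ b ∈ P.parts.attach,
      (((b.1.max' (P.nonempty_of_mem_parts b.2)).val : ℤ)
        - ((b.1.min' (P.nonempty_of_mem_parts b.2)).val : ℤ) + 1)) - n

/-- The intertwining exponent (number of 2-crossings): the number of pairs of arcs
`(i₁,j₁), (i₂,j₂)` with `i₁ < i₂ < j₁ < j₂`. -/
noncomputable def inter {n : ℕ} (P : SetPartition n) : ℕ :=
  Set.ncard {q : (Fin n × Fin n) × (Fin n × Fin n) |
    IsArc P q.1.1 q.1.2 ∧ IsArc P q.2.1 q.2.2 ∧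
    q.1.1 < q.2.1 ∧ q.2.1 < q.1.2 ∧ q.1.2 < q.2.2}

section

open scoped Classical

/-- Finpartitions of a finite type correspond to equivalence relations on it. -/
noncomputable def Finpartition.equivSetoid (α : Type*) [Fintype α] [DecidableEq α] :
    Finpartition (univ : Finset α) ≃ Setoid α where
  toFun P := Setoid.ker P.part
  invFun s := Finpartition.ofSetoid s
  left_inv P := by
    have hpart (a : α) : (Finpartition.ofSetoid (Setoid.ker P.part)).part a = P.part a := by
      ext b
      rw [Finpartition.mem_part_ofSetoid_iff_rel, P.mem_part_iff_part_eq_part (mem_univ _)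
        (mem_univ _), Setoid.ker_def, eq_comm]
    ext t
    constructor
    · intro ht
      obtain ⟨a, ha⟩ := Finpartition.nonempty_of_mem_parts _ ht
      rw [← Finpartition.part_eq_of_mem _ ht ha, hpart]
      exact P.part_mem.2 (mem_univ a)
    · intro ht
      obtain ⟨a, ha⟩ := P.nonempty_of_mem_parts ht
      rw [← P.part_eq_of_mem ht ha, ← hpart]
      exact (Finpartition.part_mem _).2 (mem_univ a)
  right_inv s := by
    ext a b
    rw [Setoid.ker_def, ← Finpartition.mem_part_iff_part_eq_part _ (mem_univ _) (mem_univ _),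
      Finpartition.mem_part_ofSetoid_iff_rel]
    exact s.comm'

noncomputable instance Setoid.instFintype (α : Type*) [Fintype α] : Fintype (Setoid α) :=
  Fintype.ofEquiv _ (Finpartition.equivSetoid α)

/-- The equivalence relations on `Fin n` for which `i` is the least element of its class. -/
noncomputable def firstSetoids {n : ℕ} (i : Fin n) : Finset (Setoid (Fin n)) :=
  {s | ∀ j, s i j → i ≤ j}

lemma mem_firstSetoids {n : ℕ} {i : Fin n} {s : Setoid (Fin n)} :
    s ∈ firstSetoids i ↔ ∀ j, s i j → i ≤ j := by
  simp [firstSetoids]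

lemma bell_eq_card_setoid (n : ℕ) : bell n = Fintype.card (Setoid (Fin n)) :=
  Fintype.card_congr (Finpartition.equivSetoid _)

lemma card_firstSetoids_zero (n : ℕ) : #(firstSetoids (0 : Fin (n + 1))) = bell (n + 1) := by
  simp [firstSetoids, bell_eq_card_setoid]

lemma card_firstSetoids_last (n : ℕ) : #(firstSetoids (Fin.last n)) = bell n := by
  rw [bell_eq_card_setoid, ← card_univ]
  have hinj : Function.Injective (Fin.castSucc : Fin n → Fin (n + 1)) := Fin.castSucc_injective n
  refine card_bij (fun s _ ↦ s.comap Fin.castSucc) (fun _ _ ↦ mem_univ _) ?_ ?_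
  · intro s hs t ht h
    rw [mem_firstSetoids] at hs ht
    have hs' (j : Fin n) : ¬ s (Fin.last n) j.castSucc := fun hj ↦
      absurd (hs _ hj) (not_le.2 (Fin.castSucc_lt_last j))
    have ht' (j : Fin n) : ¬ t (Fin.last n) j.castSucc := fun hj ↦
      absurd (ht _ hj) (not_le.2 (Fin.castSucc_lt_last j))
    ext a b
    cases a using Fin.lastCases with
    | last =>
      cases b using Fin.lastCases with
      | last => exact iff_of_true (s.refl' _) (t.refl' _)
      | cast b => simp [hs', ht']
    | cast a =>
      cases b using Fin.lastCases with
      | last => rw [s.comm', t.comm']; simp [hs', ht']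
      | cast b => exact Setoid.ext_iff.1 h a b
  · intro t _
    refine ⟨t.map Fin.castSucc, ?_, Setoid.comap_map_eq _ _ hinj⟩
    rw [mem_firstSetoids]
    intro j hj
    rw [Setoid.coe_map_of_ker_le _ _ (Setoid.ker_eq_bot_iff.2 hinj ▸ bot_le)] at hj
    rcases hj with ⟨a, b, -, ha, -⟩ | h
    · exact absurd ha (Fin.castSucc_lt_last a).ne
    · exact h.le

lemma card_firstSetoids_rel {n : ℕ} (i : Fin n) :
    #{s ∈ firstSetoids i.castSucc | s i.castSucc i.succ} = #(firstSetoids i) := by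
  have hpa (a : Fin n) : i.predAbove (i.succ.succAbove a) = a := by
    ext; simp only [Fin.predAbove, Fin.succAbove]; grind [Fin.coe_castPred]
  have hsi : i.succ.succAbove i = i.castSucc := by simp
  refine card_nbij' (fun s ↦ s.comap i.succ.succAbove) (fun t ↦ t.comap i.predAbove) ?_ ?_ ?_ ?_
  · intro s hs
    simp only [coe_filter, Set.mem_ofPred_eq, mem_firstSetoids, mem_coe, Setoid.comap_rel] at hs ⊢
    intro j hj
    have := hs.1 _ (hsi ▸ hj)
    by_contra! hlt
    rw [← hsi, Fin.succAbove_le_succAbove_iff] at this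
    exact absurd this (not_le.2 hlt)
  · intro t ht
    simp only [coe_filter, Set.mem_ofPred_eq, mem_firstSetoids, mem_coe, Setoid.comap_rel,
      Fin.predAbove_castSucc_self, Fin.predAbove_succ_self] at ht ⊢
    refine ⟨fun j hj ↦ ?_, t.refl' _⟩
    have := ht _ hj
    simp only [Fin.predAbove, Fin.le_def] at this ⊢
    split at this <;> grind [Fin.coe_castPred]
  · intro s hs
    simp only [coe_filter, Set.mem_ofPred_eq] at hs
    have hrel (a : Fin (n + 1)) : s (i.succ.succAbove (i.predAbove a)) a := by
      by_cases ha : a = i.succ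
      · subst ha
        simpa using hs.2
      · have : i.succ.succAbove (i.predAbove a) = a := by
          ext; simp only [Fin.predAbove, Fin.succAbove]; grind [Fin.coe_castPred]
        rw [this]
    ext a b
    simp only [Setoid.comap_rel]
    exact ⟨fun h ↦ s.trans' (s.symm' (hrel a)) (s.trans' h (hrel b)),
      fun h ↦ s.trans' (hrel a) (s.trans' h (s.symm' (hrel b)))⟩
  · intro t _
    ext a b
    simp [Setoid.comap_rel, hpa]

lemma card_firstSetoids_not_rel {n : ℕ} (i : Fin n) :
    #{s ∈ firstSetoids i.castSucc | ¬ s i.castSucc i.succ} = #(firstSetoids i.succ) := by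
  refine card_nbij' (fun s ↦ s.comap (Equiv.swap i.castSucc i.succ))
    (fun s ↦ s.comap (Equiv.swap i.castSucc i.succ)) ?_ ?_ ?_ ?_
  · intro s hs
    simp only [coe_filter, Set.mem_ofPred_eq, mem_firstSetoids, mem_coe, Setoid.comap_rel,
      Equiv.swap_apply_right] at hs ⊢
    intro j hj
    have := hs.1 _ hj
    grind
  · intro s hs
    simp only [coe_filter, Set.mem_ofPred_eq, mem_firstSetoids, mem_coe, Setoid.comap_rel,
      Equiv.swap_apply_left, Equiv.swap_apply_right] at hs ⊢
    refine ⟨fun j hj ↦ ?_, fun h ↦ absurd (hs _ h) (not_le.2 i.castSucc_lt_succ)⟩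
    have := hs _ hj
    grind
  · intro s _
    ext a b
    simp [Setoid.comap_rel]
  · intro s _
    ext a b
    simp [Setoid.comap_rel]

lemma card_firstSetoids_castSucc {n : ℕ} (i : Fin n) :
    #(firstSetoids i.castSucc) = #(firstSetoids i) + #(firstSetoids i.succ) := by
  rw [← card_firstSetoids_rel i, ← card_firstSetoids_not_rel i, card_filter_add_card_filter_not]

lemma sum_card_firstSetoids (n : ℕ) :
    ∑ i : Fin n, (#(firstSetoids i) : ℤ) = bell (n + 1) - bell n := by
  have h (i : Fin n) : (#(firstSetoids i) : ℤ) =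
      #(firstSetoids i.castSucc) - #(firstSetoids i.succ) := by
    rw [card_firstSetoids_castSucc]; push_cast; ring
  have h₁ := Fin.sum_univ_castSucc fun i : Fin (n + 1) ↦ (#(firstSetoids i) : ℤ)
  have h₂ := Fin.sum_univ_succ fun i : Fin (n + 1) ↦ (#(firstSetoids i) : ℤ)
  rw [card_firstSetoids_last] at h₁
  rw [card_firstSetoids_zero] at h₂
  rw [sum_congr rfl fun i _ ↦ h i, sum_sub_distrib]
  linarith

lemma Fin.sum_sub_mul_sub {n : ℕ} (g : Fin (n + 1) → ℤ) :
    ∑ i : Fin n, ((n : ℤ) - i) * (g i.castSucc - g i.succ) = (n + 1) * g 0 - ∑ i, g i := by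
  induction n with
  | zero => simp
  | succ n ih =>
    have h := ih fun i ↦ g i.succ
    rw [Fin.sum_univ_succ g, Fin.sum_univ_succ, ← sub_eq_zero]
    simp only [Fin.val_succ, Fin.succ_castSucc] at h ⊢
    push_cast
    simp only [add_sub_add_right_eq_sub, h]
    simp
    ring

lemma sum_sub_mul_card_firstSetoids (n : ℕ) :
    ∑ i : Fin n, ((n : ℤ) - i) * #(firstSetoids i) =
      (n + 2) * bell (n + 1) - bell (n + 2) := by
  have h (i : Fin n) : (#(firstSetoids i) : ℤ) =
      #(firstSetoids i.castSucc) - #(firstSetoids i.succ) := by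
    rw [card_firstSetoids_castSucc]; push_cast; ring
  simp only [h]
  rw [Fin.sum_sub_mul_sub fun i ↦ (#(firstSetoids i) : ℤ), sum_card_firstSetoids,
    card_firstSetoids_zero]
  ring

lemma sameBlock_iff_part_eq {n : ℕ} {P : SetPartition n} {i j : Fin n} :
    SameBlock P i j ↔ P.part i = P.part j := by
  rw [← P.mem_part_iff_part_eq_part (mem_univ _) (mem_univ _), P.mem_part_iff_exists]
  rfl

lemma sameBlock_iff_mem_part {n : ℕ} {P : SetPartition n} {i j : Fin n} :
    SameBlock P i j ↔ j ∈ P.part i := by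
  rw [sameBlock_iff_part_eq, P.mem_part_iff_part_eq_part (mem_univ _) (mem_univ _), eq_comm]

lemma card_isFirst {n : ℕ} (i : Fin n) :
    #{P : SetPartition n | IsFirst P i} = #(firstSetoids i) :=
  card_equiv (Finpartition.equivSetoid _) fun P ↦ by
    simp [mem_firstSetoids, IsFirst, sameBlock_iff_part_eq, Finpartition.equivSetoid,
      Setoid.ker_def]

lemma card_isLast {n : ℕ} (i : Fin n) :
    #{P : SetPartition n | IsLast P i} = #(firstSetoids i.rev) := by
  trans #{s : Setoid (Fin n) | ∀ j, s i j → j ≤ i}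
  · exact card_equiv (Finpartition.equivSetoid _) fun P ↦ by
      simp [IsLast, sameBlock_iff_part_eq, Finpartition.equivSetoid, Setoid.ker_def]
  · refine card_nbij' (fun s ↦ s.comap Fin.rev) (fun s ↦ s.comap Fin.rev) ?_ ?_ ?_ ?_
    · intro s hs
      simp only [coe_filter, mem_univ, true_and, Set.mem_ofPred_eq, mem_firstSetoids, mem_coe,
        Setoid.comap_rel, Fin.rev_rev] at hs ⊢
      exact fun j hj ↦ Fin.rev_le_iff.2 (hs _ hj)
    · intro s hs
      simp only [coe_filter, mem_univ, true_and, Set.mem_ofPred_eq, mem_firstSetoids, mem_coe,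
        Setoid.comap_rel] at hs ⊢
      exact fun j hj ↦ Fin.rev_le_rev.1 (hs _ hj)
    · intro s _
      ext a b
      simp [Setoid.comap_rel]
    · intro s _
      ext a b
      simp [Setoid.comap_rel]

lemma sum_parts_min' {n : ℕ} (P : SetPartition n) (f : Fin n → ℤ) :
    ∑ b ∈ P.parts.attach, f (b.1.min' (P.nonempty_of_mem_parts b.2)) =
      ∑ i with IsFirst P i, f i := by
  refine sum_bij' (fun b _ ↦ b.1.min' (P.nonempty_of_mem_parts b.2))
    (fun i _ ↦ ⟨P.part i, P.part_mem.2 (mem_univ i)⟩) ?_ ?_ ?_ ?_ ?_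
  · intro b _
    simp only [mem_filter, mem_univ, true_and, IsFirst, sameBlock_iff_mem_part]
    intro j hj
    rw [P.part_eq_of_mem b.2 (min'_mem _ _)] at hj
    exact min'_le _ _ hj
  · exact fun _ _ ↦ mem_attach _ _
  · exact fun b _ ↦ Subtype.ext (P.part_eq_of_mem b.2 (min'_mem _ _))
  · intro i hi
    simp only [mem_filter, mem_univ, true_and, IsFirst, sameBlock_iff_mem_part] at hi
    exact le_antisymm (min'_le _ _ (P.mem_part (mem_univ i))) (hi _ (min'_mem _ _))
  · exact fun _ _ ↦ rfl

lemma sum_parts_max' {n : ℕ} (P : SetPartition n) (f : Fin n → ℤ) :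
    ∑ b ∈ P.parts.attach, f (b.1.max' (P.nonempty_of_mem_parts b.2)) =
      ∑ i with IsLast P i, f i := by
  refine sum_bij' (fun b _ ↦ b.1.max' (P.nonempty_of_mem_parts b.2))
    (fun i _ ↦ ⟨P.part i, P.part_mem.2 (mem_univ i)⟩) ?_ ?_ ?_ ?_ ?_
  · intro b _
    simp only [mem_filter, mem_univ, true_and, IsLast, sameBlock_iff_mem_part]
    intro j hj
    rw [P.part_eq_of_mem b.2 (max'_mem _ _)] at hj
    exact le_max' _ _ hj
  · exact fun _ _ ↦ mem_attach _ _
  · exact fun b _ ↦ Subtype.ext (P.part_eq_of_mem b.2 (max'_mem _ _))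
  · intro i hi
    simp only [mem_filter, mem_univ, true_and, IsLast, sameBlock_iff_mem_part] at hi
    exact le_antisymm (hi _ (max'_mem _ _)) (le_max' _ _ (P.mem_part (mem_univ i)))
  · exact fun _ _ ↦ rfl

lemma dimExp_eq {n : ℕ} (P : SetPartition n) :
    dimExp P = ∑ i with IsLast P i, (i : ℤ) + ∑ i with IsFirst P i, (1 - (i : ℤ)) - n := by
  rw [← sum_parts_max' P fun i ↦ (i : ℤ), ← sum_parts_min' P fun i ↦ 1 - (i : ℤ),
    ← sum_add_distrib, dimExp]
  congr 1
  exact sum_congr rfl fun b _ ↦ by ring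

lemma sum_sum_filter {α β : Type*} [Fintype α] [Fintype β] (p : α → β → Prop) (f : β → ℤ) :
    ∑ a, ∑ b with p a b, f b = ∑ b, f b * #{a | p a b} := by
  simp only [sum_filter]
  rw [sum_comm]
  refine sum_congr rfl fun b _ ↦ ?_
  rw [← sum_filter, sum_const, nsmul_eq_mul, mul_comm]

end

/-- `Σ_{λ ∈ Π(n)} d(λ) = -2B_{n+2} + (n+4)B_{n+1}`. -/
theorem sum_dimExp (n : ℕ) (hn : 1 ≤ n) :
    (∑ P : SetPartition n, dimExp P) =
      -2 * (bell (n + 2) : ℤ) + ((n : ℤ) + 4) * bell (n + 1) := by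
  classical
  have hlast : ∑ i : Fin n, (i : ℤ) * #(firstSetoids i.rev) =
      ∑ i : Fin n, ((n : ℤ) - 1 - i) * #(firstSetoids i) := by
    refine Fintype.sum_equiv Fin.revPerm _ _ fun i ↦ ?_
    have : ((Fin.rev i : ℕ) : ℤ) = n - 1 - i := by
      rw [Fin.val_rev]; omega
    simp only [Fin.revPerm_apply, this]
    ring
  have hsum : ∑ i : Fin n, ((n : ℤ) - 1 - i) * #(firstSetoids i) +
      ∑ i : Fin n, (1 - (i : ℤ)) * #(firstSetoids i) =
      2 * ∑ i : Fin n, ((n : ℤ) - i) * #(firstSetoids i) -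
        n * ∑ i : Fin n, (#(firstSetoids i) : ℤ) := by
    rw [mul_sum, mul_sum, ← sum_add_distrib, ← sum_sub_distrib]
    exact sum_congr rfl fun i _ ↦ by ring
  have hcard : ∑ _P : SetPartition n, (n : ℤ) = n * bell n := by
    rw [sum_const, card_univ, nsmul_eq_mul, mul_comm]; rfl
  rw [sum_congr rfl fun P _ ↦ dimExp_eq P, sum_sub_distrib, sum_add_distrib,
    sum_sum_filter, sum_sum_filter, hcard]
  simp only [card_isLast, card_isFirst]
  rw [hlast, hsum, sum_sub_mul_card_firstSetoids, sum_card_firstSetoids]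
  ring
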